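/- arXiv:1407.3096 — 2 statements merged into one kernel-verified Lean document; each statement's English description precedes it below -/
import Mathlib

section
/- Assume (f_i)_{i=1}^N satisfies the open set condition. Then for every r ∈ (0,∞) the quantization dimension of order r of the in-homogeneous self-similar measure μ exists and equals ξ_r; that is, log n / (− log e_{n,r}(μ)) → ξ_r as n → ∞. -/
open MeasureTheory Filter

/-- The `n`-th quantization error of order `r` of a Borel measure `P` on `ℝ^q`:
the infimum of `(∫ d(x,α)^r dP)^{1/r}` over finite sets `α` with `1 ≤ card α ≤ n`. -/
noncomputable def quantErr {q : ℕ} (P : Measure (EuclideanSpace ℝ (Fin q)))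
    (n : ℕ) (r : ℝ) : ℝ :=
  sInf ((fun α : Finset (EuclideanSpace ℝ (Fin q)) =>
      (∫ x, Metric.infDist x (α : Set (EuclideanSpace ℝ (Fin q))) ^ r ∂P) ^ (1 / r)) ''
    {α : Finset (EuclideanSpace ℝ (Fin q)) | α.Nonempty ∧ α.card ≤ n})

/-- Product of weights `g` along a word `σ` (equals `1` for the empty word). -/
noncomputable def prodw {N : ℕ} (g : Fin N → ℝ) (σ : List (Fin N)) : ℝ := (σ.map g).prod

/-- The composition `f_{σ_1} ∘ ⋯ ∘ f_{σ_n}` along a word `σ`. -/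
def wordMap {q N : ℕ} (f : Fin N → EuclideanSpace ℝ (Fin q) → EuclideanSpace ℝ (Fin q))
    (σ : List (Fin N)) : EuclideanSpace ℝ (Fin q) → EuclideanSpace ℝ (Fin q) :=
  σ.foldr (fun i g => f i ∘ g) id

/-- `h(σ) = h^{(1)}(σ) + h^{(2)}(σ)` where
`h^{(1)}(σ) = Σ_{j=0}^{|σ|-1} p0 p_{σ|_j} t_{σ^{(l)}_{-j}} s_σ^r` and `h^{(2)}(σ) = p_σ s_σ^r`. -/
noncomputable def hfun {N : ℕ} (r p0 : ℝ) (s t p : Fin N → ℝ) (σ : List (Fin N)) : ℝ :=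
  (∑ j ∈ Finset.range σ.length, p0 * prodw p (σ.take j) * prodw t (σ.drop j)) * prodw s σ ^ r
    + prodw p σ * prodw s σ ^ r

/-- `η̲_r := min_{1 ≤ i ≤ N} min{p0 t_i + p_i, t_i} · s_i^r`. -/
noncomputable def etaLow {N : ℕ} (r p0 : ℝ) (s t p : Fin N → ℝ) : ℝ :=
  ⨅ i, min (p0 * t i + p i) (t i) * s i ^ r

/-- The finite maximal antichain `Λ_{k,r} = {σ : h(σ|_{|σ|-1}) ≥ η̲_r/k > h(σ)}`. -/
def Lam {N : ℕ} (r p0 : ℝ) (s t p : Fin N → ℝ) (k : ℕ) : Set (List (Fin N)) :=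
  {σ | σ ≠ [] ∧ etaLow r p0 s t p / k ≤ hfun r p0 s t p σ.dropLast ∧
    hfun r p0 s t p σ < etaLow r p0 s t p / k}

/-- `a(x) = Σ_i (t_i s_i^r)^{x/(x+r)}` (also used for `b` with `p` in place of `t`). -/
noncomputable def afun {N : ℕ} (r : ℝ) (s t : Fin N → ℝ) (x : ℝ) : ℝ :=
  ∑ i, (t i * s i ^ r) ^ (x / (x + r))

open scoped ENNReal

/-- Rates of decay propagate through a self-similar recursion: if `Q n v` (read: an error at most
`v` is achievable with `n` points) is stable under the recursion with coefficients `c i` and the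
corresponding normalized weights `w i` have sum less than `1`, then `Q n (C * n ^ (-β))` holds. -/
theorem exists_rpow_bound_of_recursion {ι : Type*} [Fintype ι] (Q : ℕ → ℝ → Prop)
    (c w : ι → ℝ) (β K : ℝ) (hβ : 0 < β) (hK : 0 ≤ K) (hc : ∀ i, 0 < c i)
    (hw0 : ∀ i, 0 < w i) (hw1 : ∑ i, w i < 1) (hcw : ∀ i, c i * w i ^ (-β) = w i)
    (hmono : ∀ n v v', Q n v → v ≤ v' → Q n v')
    (hbase : ∃ D, ∀ n, 1 ≤ n → Q n D)
    (hstep : ∀ (n m : ℕ) (k : ι → ℕ) (v : ι → ℝ), 1 ≤ m → (∀ i, 1 ≤ k i) →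
      m + ∑ i, k i ≤ n → (∀ i, 0 ≤ v i) → (∀ i, Q (k i) (v i)) →
      Q n (K * (m : ℝ) ^ (-β) + ∑ i, c i * v i)) :
    ∃ C, 0 < C ∧ ∀ n : ℕ, 1 ≤ n → Q n (C * (n : ℝ) ^ (-β)) := by
  set ρ := ∑ i, w i with hρ
  obtain ⟨D, hD⟩ := hbase
  have hw1' : ∀ i, w i < 1 := fun i =>
    (Finset.single_le_sum (fun j _ => (hw0 j).le) (Finset.mem_univ i)).trans_lt hw1
  obtain ⟨l, hl0, hl1, hlρ⟩ : ∃ l : ℝ, 0 < l ∧ l < 1 ∧ ρ * l ^ (-β) < 1 := by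
    have h1 : Tendsto (fun l : ℝ => ρ * l ^ (-β)) (nhdsWithin 1 (Set.Iio 1)) (nhds ρ) := by
      have : ContinuousAt (fun l : ℝ => ρ * l ^ (-β)) 1 :=
        continuousAt_const.mul (Real.continuousAt_rpow_const _ _ (Or.inl one_ne_zero))
      have h2 := this.tendsto.mono_left (nhdsWithin_le_nhds (s := Set.Iio 1))
      simpa using h2
    have h3 : ∀ᶠ l : ℝ in nhdsWithin 1 (Set.Iio 1), l ∈ Set.Ioo (0 : ℝ) 1 :=
      Ioo_mem_nhdsLT zero_lt_one
    obtain ⟨l, hl, hl'⟩ := ((h1.eventually (gt_mem_nhds hw1)).and h3).exists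
    exact ⟨l, hl'.1, hl'.2, hl⟩
  have hfloor : ∀ a : ℝ, 0 < a → ∀ᶠ n : ℕ in atTop,
      1 ≤ ⌊(n : ℝ) * a⌋₊ ∧ l * (n * a) ≤ ⌊(n : ℝ) * a⌋₊ := by
    intro a ha
    have h1 : Tendsto (fun n : ℕ => (n : ℝ) * a) atTop atTop :=
      tendsto_natCast_atTop_atTop.atTop_mul_const ha
    filter_upwards [h1.eventually_ge_atTop 1, h1.eventually_ge_atTop (1 / (1 - l))] with n hn hn'
    refine ⟨Nat.le_floor (by simpa using hn), ?_⟩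
    have h2 := Nat.lt_floor_add_one ((n : ℝ) * a)
    rw [div_le_iff₀ (by linarith)] at hn'
    nlinarith
  obtain ⟨n₀, hn₀⟩ := eventually_atTop.1
    ((eventually_all.2 fun i => hfloor (w i) (hw0 i)).and (hfloor (1 - ρ) (by linarith)))
  set A := K * (l * (1 - ρ)) ^ (-β) with hA
  set ρ' := ρ * l ^ (-β) with hρ'
  refine ⟨max (max (D * (n₀ : ℝ) ^ β) (A / (1 - ρ'))) 1, by positivity, ?_⟩
  set C := max (max (D * (n₀ : ℝ) ^ β) (A / (1 - ρ'))) 1 with hC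
  have hC0 : 0 < C := by positivity
  intro n
  induction n using Nat.strong_induction_on with
  | _ n ih =>
  intro hn
  have hn0 : (0 : ℝ) < n := by exact_mod_cast hn
  rcases lt_or_ge n n₀ with hlt | hge
  · refine hmono _ _ _ (hD n hn) ?_
    have h1 : D * (n₀ : ℝ) ^ β ≤ C := (le_max_left _ _).trans (le_max_left _ _)
    have h2 : (n : ℝ) ^ β ≤ (n₀ : ℝ) ^ β := by gcongr
    rw [Real.rpow_neg hn0.le, ← div_eq_mul_inv, le_div_iff₀ (by positivity)]
    rcases le_or_gt 0 D with hD0 | hD0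
    · exact (mul_le_mul_of_nonneg_left h2 hD0).trans h1
    · have : 0 < (n : ℝ) ^ β := by positivity
      nlinarith
  · obtain ⟨hk, hm1, hm2⟩ := hn₀ n hge
    have hkn : ∀ i, ⌊(n : ℝ) * w i⌋₊ < n := fun i => by
      have h1 := Nat.floor_le (show 0 ≤ (n : ℝ) * w i by have := hw0 i; positivity)
      have : (n : ℝ) * w i < n := by nlinarith [hw1' i]
      exact_mod_cast h1.trans_lt this
    have hsum : ⌊(n : ℝ) * (1 - ρ)⌋₊ + ∑ i, ⌊(n : ℝ) * w i⌋₊ ≤ n := by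
      have h1 := Nat.floor_le (show 0 ≤ (n : ℝ) * (1 - ρ) from mul_nonneg hn0.le (by linarith))
      have h2 : ∑ i, (⌊(n : ℝ) * w i⌋₊ : ℝ) ≤ ∑ i, (n : ℝ) * w i :=
        Finset.sum_le_sum fun i _ => Nat.floor_le (by have := hw0 i; positivity)
      rw [← Finset.mul_sum] at h2
      have : ((⌊(n : ℝ) * (1 - ρ)⌋₊ + ∑ i, ⌊(n : ℝ) * w i⌋₊ : ℕ) : ℝ) ≤ n := by
        push_cast
        linarith
      exact_mod_cast this
    refine hmono _ _ _ (hstep n _ _ (fun i => C * (⌊(n : ℝ) * w i⌋₊ : ℝ) ^ (-β)) hm1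
      (fun i => (hk i).1) hsum (fun i => by positivity)
      (fun i => ih _ (hkn i) (hk i).1)) ?_
    have h1 : K * (⌊(n : ℝ) * (1 - ρ)⌋₊ : ℝ) ^ (-β) ≤ A * (n : ℝ) ^ (-β) := by
      have h1ρ : 0 < 1 - ρ := by linarith
      rw [hA, mul_assoc, ← Real.mul_rpow (by positivity) hn0.le]
      refine mul_le_mul_of_nonneg_left ?_ hK
      refine Real.rpow_le_rpow_of_nonpos (by positivity) ?_ (by linarith)
      linarith
    have h2 : ∑ i, c i * (C * (⌊(n : ℝ) * w i⌋₊ : ℝ) ^ (-β)) ≤ C * ρ' * (n : ℝ) ^ (-β) := by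
      have : ∀ i, c i * (C * (⌊(n : ℝ) * w i⌋₊ : ℝ) ^ (-β)) ≤
          C * l ^ (-β) * (n : ℝ) ^ (-β) * w i := by
        intro i
        have hwi := hw0 i
        have h3 : (⌊(n : ℝ) * w i⌋₊ : ℝ) ^ (-β) ≤ l ^ (-β) * ((n : ℝ) ^ (-β) * w i ^ (-β)) := by
          rw [← Real.mul_rpow hn0.le hwi.le, ← Real.mul_rpow hl0.le (by positivity)]
          exact Real.rpow_le_rpow_of_nonpos (by positivity) (hk i).2 (by linarith)
        calc c i * (C * (⌊(n : ℝ) * w i⌋₊ : ℝ) ^ (-β))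
            ≤ c i * (C * (l ^ (-β) * ((n : ℝ) ^ (-β) * w i ^ (-β)))) := by
              have := hc i
              gcongr
          _ = C * l ^ (-β) * (n : ℝ) ^ (-β) * (c i * w i ^ (-β)) := by ring
          _ = _ := by rw [hcw]
      calc _ ≤ ∑ i, C * l ^ (-β) * (n : ℝ) ^ (-β) * w i := Finset.sum_le_sum fun i _ => this i
        _ = _ := by rw [← Finset.mul_sum, ← hρ, hρ']; ring
    have h3 : A + C * ρ' ≤ C := by
      have : A / (1 - ρ') ≤ C := (le_max_right _ _).trans (le_max_left _ _)
      rw [div_le_iff₀ (by linarith)] at this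
      linarith
    have h4 : 0 < (n : ℝ) ^ (-β) := by positivity
    calc _ ≤ A * (n : ℝ) ^ (-β) + C * ρ' * (n : ℝ) ^ (-β) := add_le_add h1 h2
      _ = (A + C * ρ') * (n : ℝ) ^ (-β) := by ring
      _ ≤ _ := mul_le_mul_of_nonneg_right h3 h4.le

section Distortion

variable {X : Type*} [MetricSpace X] [MeasurableSpace X]

/-- The distortion `∫ d(x, α)^r dP` of a finite codebook `α`, as an extended nonnegative real. -/
noncomputable def distortion (P : Measure X) (r : ℝ) (α : Finset X) : ℝ≥0∞ :=
  ∫⁻ x, ENNReal.ofReal (Metric.infDist x (α : Set X) ^ r) ∂P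

theorem measurable_ofReal_infDist_rpow [BorelSpace X] (r : ℝ) (A : Set X) :
    Measurable fun x => ENNReal.ofReal (Metric.infDist x A ^ r) :=
  ((Metric.continuous_infDist_pt A).measurable.pow_const r).ennreal_ofReal

theorem integral_infDist_rpow_eq_toReal_distortion [BorelSpace X] (P : Measure X) (r : ℝ)
    (α : Finset X) :
    ∫ x, Metric.infDist x (α : Set X) ^ r ∂P = (distortion P r α).toReal :=
  integral_eq_lintegral_of_nonneg_ae
    (Eventually.of_forall fun _ => Real.rpow_nonneg Metric.infDist_nonneg _)
    ((Metric.continuous_infDist_pt _).measurable.pow_const r).aestronglyMeasurable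

theorem distortion_mono (P : Measure X) {r : ℝ} (hr : 0 < r) {α β : Finset X} (hα : α.Nonempty)
    (h : α ⊆ β) : distortion P r β ≤ distortion P r α := by
  refine lintegral_mono fun x => ENNReal.ofReal_le_ofReal ?_
  exact Real.rpow_le_rpow Metric.infDist_nonneg
    (Metric.infDist_le_infDist_of_subset (by exact_mod_cast h) (by exact_mod_cast hα)) hr.le

theorem lintegral_comp_similarity_le (P : Measure X) {r : ℝ} (hr : 0 < r)
    {g : X → X} {c : ℝ} (hc : 0 < c) (hg : ∀ x y, dist (g x) (g y) = c * dist x y)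
    {α β : Finset X} (hα : α.Nonempty) (h : ∀ a ∈ α, g a ∈ β) :
    ∫⁻ x, ENNReal.ofReal (Metric.infDist (g x) (β : Set X) ^ r) ∂P ≤
      ENNReal.ofReal (c ^ r) * distortion P r α := by
  rw [distortion, ← lintegral_const_mul' _ _ ENNReal.ofReal_ne_top]
  refine lintegral_mono fun x => ?_
  dsimp only
  rw [← ENNReal.ofReal_mul (by positivity), ← Real.mul_rpow hc.le Metric.infDist_nonneg]
  refine ENNReal.ofReal_le_ofReal (Real.rpow_le_rpow Metric.infDist_nonneg ?_ hr.le)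
  obtain ⟨y, hy, hxy⟩ := α.finite_toSet.isCompact.exists_infDist_eq_dist
    (by exact_mod_cast hα : (α : Set X).Nonempty) x
  rw [hxy, ← hg]
  exact Metric.infDist_le_dist_of_mem (by exact_mod_cast h y hy)

theorem exists_distortion_le (P : Measure X) [IsProbabilityMeasure P]
    (hP : ∃ K, IsCompact K ∧ P Kᶜ = 0) {r : ℝ} (hr : 0 < r) {α : Finset X} (hα : α.Nonempty) :
    ∃ D : ℝ, 0 ≤ D ∧ distortion P r α ≤ ENNReal.ofReal D := by
  obtain ⟨K, hK, hPK⟩ := hP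
  obtain ⟨a, ha⟩ := hα
  obtain ⟨R, hR⟩ := hK.isBounded.subset_closedBall a
  refine ⟨(max R 0) ^ r, by positivity, ?_⟩
  calc distortion P r α ≤ ∫⁻ _, ENNReal.ofReal ((max R 0) ^ r) ∂P := by
        refine lintegral_mono_ae ?_
        have : ∀ᵐ x ∂P, x ∈ K := hPK
        filter_upwards [this] with x hx
        refine ENNReal.ofReal_le_ofReal (Real.rpow_le_rpow Metric.infDist_nonneg ?_ hr.le)
        exact (Metric.infDist_le_dist_of_mem (by exact_mod_cast ha)).trans
          ((Metric.mem_closedBall.1 (hR hx)).trans (le_max_left _ _))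
    _ = _ := by simp

end Distortion

theorem lintegral_inhomogeneous {X ι : Type*} [MeasurableSpace X] [Fintype ι] {μ ν : Measure X}
    {f : ι → X → X} (hf : ∀ i, Measurable (f i)) {a : ℝ} {p : ι → ℝ}
    (hμ : μ = ENNReal.ofReal a • ν + ∑ i, ENNReal.ofReal (p i) • μ.map (f i))
    {h : X → ℝ≥0∞} (hh : Measurable h) :
    ∫⁻ x, h x ∂μ = ENNReal.ofReal a * ∫⁻ x, h x ∂ν +
      ∑ i, ENNReal.ofReal (p i) * ∫⁻ x, h (f i x) ∂μ := by
  conv_lhs => rw [hμ]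
  rw [lintegral_add_measure, lintegral_finsetSum_measure]
  simp only [lintegral_smul_measure, smul_eq_mul]
  congr 1
  exact Finset.sum_congr rfl fun i _ => by rw [lintegral_map hh (hf i)]

section UpperBound

variable {X : Type*} [MetricSpace X] [MeasurableSpace X] [BorelSpace X] {ι : Type*} [Fintype ι]

/-- Upper bound for the decay of the distortion of an in-homogeneous self-similar measure, given
the same rate for the condensation measure (up to the factor `a`, which may vanish). -/
theorem exists_codebook_rpow_bound [Nonempty ι] [Nonempty X] {μ ν : Measure X}
    [IsProbabilityMeasure μ] (hμc : ∃ K, IsCompact K ∧ μ Kᶜ = 0) {f : ι → X → X} {s : ι → ℝ}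
    (hs : ∀ i, 0 < s i) (hf : ∀ i x y, dist (f i x) (f i y) = s i * dist x y)
    {a : ℝ} {p : ι → ℝ} (hp : ∀ i, 0 < p i)
    (hμ : μ = ENNReal.ofReal a • ν + ∑ i, ENNReal.ofReal (p i) • μ.map (f i))
    {r ξ : ℝ} (hr : 0 < r) (hξ : 0 < ξ) (hsum : ∑ i, (p i * s i ^ r) ^ (ξ / (ξ + r)) < 1)
    {K : ℝ} (hK : 0 ≤ K)
    (hν : ∀ m : ℕ, 1 ≤ m → ∃ α : Finset X, α.Nonempty ∧ α.card ≤ m ∧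
      ENNReal.ofReal a * distortion ν r α ≤ ENNReal.ofReal (K * (m : ℝ) ^ (-(r / ξ)))) :
    ∃ C, 0 < C ∧ ∀ n : ℕ, 1 ≤ n → ∃ α : Finset X, α.Nonempty ∧ α.card ≤ n ∧
      distortion μ r α ≤ ENNReal.ofReal (C * (n : ℝ) ^ (-(r / ξ))) := by
  classical
  have hc : ∀ i, 0 < p i * s i ^ r := fun i => by have := hp i; have := hs i; positivity
  have hfm : ∀ i, Measurable (f i) := fun i =>
    (LipschitzWith.of_dist_le_mul (K := ⟨s i, (hs i).le⟩)
      fun x y => (hf i x y).le).continuous.measurable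
  refine exists_rpow_bound_of_recursion
    (fun n v => ∃ α : Finset X, α.Nonempty ∧ α.card ≤ n ∧ distortion μ r α ≤ ENNReal.ofReal v)
    (fun i => p i * s i ^ r) (fun i => (p i * s i ^ r) ^ (ξ / (ξ + r))) (r / ξ) K
    (by positivity) hK hc (fun i => Real.rpow_pos_of_pos (hc i) _) hsum ?_ ?_ ?_ ?_
  · intro i
    rw [← Real.rpow_mul (hc i).le]
    nth_rewrite 1 [← Real.rpow_one (p i * s i ^ r)]
    rw [← Real.rpow_add (hc i)]
    congr 1
    field_simp
    ring
  · rintro n v v' ⟨α, h1, h2, h3⟩ hv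
    exact ⟨α, h1, h2, h3.trans (ENNReal.ofReal_le_ofReal hv)⟩
  · obtain ⟨x⟩ := ‹Nonempty X›
    obtain ⟨D, -, hD⟩ := exists_distortion_le μ hμc hr (Finset.singleton_nonempty x)
    exact ⟨D, fun n hn => ⟨{x}, Finset.singleton_nonempty x, by simpa using hn, hD⟩⟩
  · intro n m k v hm hk hsum hv hQ
    obtain ⟨β, hβ, hβm, hβ'⟩ := hν m hm
    choose α hα hαk hα' using hQ
    set γ : Finset X := β ∪ Finset.univ.biUnion fun i => (α i).image (f i) with hγ
    refine ⟨γ, hβ.mono Finset.subset_union_left, ?_, ?_⟩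
    · refine (Finset.card_union_le _ _).trans (le_trans ?_ hsum)
      refine add_le_add hβm (Finset.card_biUnion_le.trans (Finset.sum_le_sum fun i _ => ?_))
      exact Finset.card_image_le.trans (hαk i)
    · rw [distortion, lintegral_inhomogeneous hfm hμ (measurable_ofReal_infDist_rpow r _),
        ENNReal.ofReal_add (by positivity)
          (Finset.sum_nonneg fun i _ => mul_nonneg (hc i).le (hv i)),
        ENNReal.ofReal_sum_of_nonneg fun i _ => mul_nonneg (hc i).le (hv i)]
      refine add_le_add (le_trans ?_ hβ') (Finset.sum_le_sum fun i _ => ?_)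
      · exact mul_le_mul_right (distortion_mono ν hr hβ Finset.subset_union_left) _
      · rw [ENNReal.ofReal_mul (hc i).le, ENNReal.ofReal_mul (hp i).le, mul_assoc]
        refine mul_le_mul_right ?_ _
        refine (lintegral_comp_similarity_le μ hr (hs i) (hf i) (hα i) fun x hx => ?_).trans
          (mul_le_mul_right (hα' i) _)
        exact Finset.mem_union_right _ (Finset.mem_biUnion.2
          ⟨i, Finset.mem_univ i, Finset.mem_image_of_mem _ hx⟩)

end UpperBound

/-- A family of similarities `g i` with ratios `ρ i` satisfying the open set condition with
the open set `U`, such that `μ` dominates the sum of its images under `g i` weighted by `w i`. -/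
structure IsSubsystem {X ι : Type*} [MetricSpace X] [MeasurableSpace X] [Fintype ι]
    (μ : Measure X) (U : Set X) (g : ι → X → X) (ρ w : ι → ℝ) : Prop where
  dist_eq : ∀ i x y, dist (g i x) (g i y) = ρ i * dist x y
  ratio_pos : ∀ i, 0 < ρ i
  weight_pos : ∀ i, 0 < w i
  image_subset : ∀ i, g i '' U ⊆ U
  disjoint : Pairwise fun i j => Disjoint (g i '' U) (g j '' U)
  sum_lintegral_le : ∀ h : X → ℝ≥0∞, Measurable h →
    ∑ i, ENNReal.ofReal (w i) * ∫⁻ x, h (g i x) ∂μ ≤ ∫⁻ x, h x ∂μ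

/-- The composition `g (ω 0) ∘ ⋯ ∘ g (ω (n - 1))`. -/
def iterMap {X ι : Type*} (g : ι → X → X) : (n : ℕ) → (Fin n → ι) → X → X
  | 0, _ => id
  | n + 1, ω => g (ω 0) ∘ iterMap g n (Fin.tail ω)

namespace IsSubsystem

variable {X ι : Type*} [MetricSpace X] [MeasurableSpace X] [Fintype ι] {μ : Measure X} {U : Set X}
  {g : ι → X → X} {ρ w : ι → ℝ}

theorem injective (h : IsSubsystem μ U g ρ w) (i : ι) : Function.Injective (g i) := by
  intro x y hxy
  have := h.dist_eq i x y
  rw [hxy, dist_self, eq_comm, mul_eq_zero] at this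
  exact dist_eq_zero.1 (this.resolve_left (h.ratio_pos i).ne')

theorem continuous (h : IsSubsystem μ U g ρ w) (i : ι) : Continuous (g i) :=
  (LipschitzWith.of_dist_le_mul (K := ⟨ρ i, (h.ratio_pos i).le⟩)
    fun x y => (h.dist_eq i x y).le).continuous

theorem comp_injective {κ : Type*} [Fintype κ] (h : IsSubsystem μ U g ρ w) {e : κ → ι}
    (he : Function.Injective e) : IsSubsystem μ U (g ∘ e) (ρ ∘ e) (w ∘ e) where
  dist_eq i := h.dist_eq (e i)
  ratio_pos i := h.ratio_pos (e i)
  weight_pos i := h.weight_pos (e i)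
  image_subset i := h.image_subset (e i)
  disjoint i j hij := h.disjoint (he.ne hij)
  sum_lintegral_le φ hφ := by
    classical
    refine le_trans ?_ (h.sum_lintegral_le φ hφ)
    refine (Finset.sum_image (s := Finset.univ) (g := e)
      (f := fun i => ENNReal.ofReal (w i) * ∫⁻ x, φ (g i x) ∂μ) he.injOn).symm.trans_le ?_
    exact Finset.sum_le_sum_of_subset (Finset.subset_univ _)

theorem iterate [BorelSpace X] (h : IsSubsystem μ U g ρ w) (n : ℕ) :
    IsSubsystem μ U (iterMap g n) (fun ω => ∏ j, ρ (ω j)) (fun ω => ∏ j, w (ω j)) := by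
  induction n with
  | zero =>
    refine ⟨by simp [iterMap], by simp, by simp, by simp [iterMap], ?_, ?_⟩
    · intro i j hij
      exact absurd (Subsingleton.elim i j) hij
    · simp [iterMap]
  | succ n ih =>
    refine ⟨?_, fun ω => Finset.prod_pos fun _ _ => h.ratio_pos _,
      fun ω => Finset.prod_pos fun _ _ => h.weight_pos _, ?_, ?_, ?_⟩
    · intro ω x y
      simp only [iterMap, Function.comp_apply]
      rw [h.dist_eq, ih.dist_eq, Fin.prod_univ_succ, mul_assoc]
      rfl
    · intro ω
      rw [iterMap, Set.image_comp]
      exact (Set.image_mono (ih.image_subset _)).trans (h.image_subset _)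
    · intro ω ω' hω
      simp only [iterMap, Set.image_comp]
      by_cases h0 : ω 0 = ω' 0
      · rw [h0]
        refine (Set.disjoint_image_iff (h.injective _)).2 (ih.disjoint fun ht => hω ?_)
        rw [← Fin.cons_self_tail ω, ← Fin.cons_self_tail ω', h0, ht]
      · exact (h.disjoint h0).mono (Set.image_mono (ih.image_subset _))
          (Set.image_mono (ih.image_subset _))
    · intro φ hφ
      rw [← (Fin.consEquiv fun _ : Fin (n + 1) => ι).sum_comp, Fintype.sum_prod_type]
      refine le_trans (Finset.sum_le_sum fun i _ => ?_) (h.sum_lintegral_le φ hφ)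
      refine le_trans (le_of_eq ?_) (mul_le_mul_right
        (ih.sum_lintegral_le (fun x => φ (g i x)) (hφ.comp (h.continuous i).measurable)) _)
      rw [Finset.mul_sum]
      refine Finset.sum_congr rfl fun ω _ => ?_
      rw [← mul_assoc, ← ENNReal.ofReal_mul (h.weight_pos i).le, Fin.prod_univ_succ]
      simp [iterMap, Fin.consEquiv, Fin.tail_cons]

end IsSubsystem

section LowerBound

variable {X : Type*} [NormedAddCommGroup X] [NormedSpace ℝ X] [FiniteDimensional ℝ X]
  [MeasurableSpace X] [BorelSpace X]

/-- Under the open set condition only boundedly many pieces of common ratio `S` come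
`S`-close to a given point. -/
theorem exists_card_near_le {U B : Set X} (hU : IsOpen U) (hUne : U.Nonempty)
    (hB : Bornology.IsBounded B) :
    ∃ M : ℕ, ∀ (κ : Type) [Fintype κ] (g : κ → X → X) (S : ℝ), 0 < S →
      (∀ i x y, dist (g i x) (g i y) = S * dist x y) →
      (Pairwise fun i j => Disjoint (g i '' U) (g j '' U)) →
      ∀ (a : X) (T : Finset κ), (∀ i ∈ T, ∃ x ∈ B, dist (g i x) a < S) → T.card ≤ M := by
  obtain ⟨u, hu⟩ := hUne
  obtain ⟨c, hc, hcU⟩ := Metric.nhds_basis_closedBall.mem_iff.1 (hU.mem_nhds hu)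
  obtain ⟨D, hD0, hD⟩ : ∃ D : ℝ, 0 < D ∧
      ∀ x ∈ B, ∀ y ∈ Metric.closedBall u c, dist y x ≤ D := by
    obtain ⟨D, hD⟩ := Metric.isBounded_iff.1 (hB.union Metric.isBounded_closedBall)
    exact ⟨max D 1, by positivity, fun x hx y hy =>
      (hD (Set.mem_union_right _ hy) (Set.mem_union_left _ hx)).trans (le_max_left _ _)⟩
  set d := Module.finrank ℝ X with hd
  set V : Measure X := Measure.hausdorffMeasure (d : ℝ) with hV
  have : V.IsAddHaarMeasure := isAddHaarMeasure_hausdorffMeasure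
  set v := V (Metric.ball 0 1) with hv
  have hv0 : v ≠ 0 := (Metric.measure_ball_pos V 0 one_pos).ne'
  have hv1 : v ≠ ⊤ := measure_ball_lt_top.ne
  refine ⟨⌊((D + 1) / c) ^ d⌋₊, fun κ _ g S hS hg hdisj a T hT => ?_⟩
  have hlip : ∀ i, LipschitzWith ⟨S, hS.le⟩ (g i) := fun i =>
    LipschitzWith.of_dist_le_mul fun x y => (hg i x y).le
  have hsub : ∀ i ∈ T, g i '' Metric.closedBall u c ⊆ Metric.closedBall a (S * (D + 1)) := by
    rintro i hi _ ⟨y, hy, rfl⟩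
    obtain ⟨x, hx, hxa⟩ := hT i hi
    rw [Metric.mem_closedBall]
    have h1 := dist_triangle (g i y) (g i x) a
    rw [hg] at h1
    have h2 := mul_le_mul_of_nonneg_left (hD x hx y hy) hS.le
    linarith
  have hmeas : ∀ i, ENNReal.ofReal ((S * c) ^ d) * v ≤ V (g i '' Metric.closedBall u c) := by
    intro i
    have hanti : AntilipschitzWith ⟨S⁻¹, by positivity⟩ (g i) :=
      AntilipschitzWith.of_le_mul_dist fun x y => by
        rw [hg]
        change _ ≤ S⁻¹ * _
        rw [← mul_assoc, inv_mul_cancel₀ hS.ne', one_mul]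
    have h1 := hanti.le_hausdorffMeasure_image (d := (d : ℝ)) (by positivity)
      (Metric.closedBall u c)
    rw [← hV, Measure.addHaar_closedBall V u hc.le, ← hd, ← hv] at h1
    have h2 : ENNReal.ofNNReal ⟨S⁻¹, by positivity⟩ = ENNReal.ofReal S⁻¹ :=
      (ENNReal.ofReal_eq_coe_nnreal _).symm
    rw [h2, ENNReal.rpow_natCast, ← ENNReal.ofReal_pow (by positivity)] at h1
    calc ENNReal.ofReal ((S * c) ^ d) * v
        = ENNReal.ofReal (S ^ d) * (ENNReal.ofReal (c ^ d) * v) := by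
          rw [mul_pow, ENNReal.ofReal_mul (by positivity), mul_assoc]
      _ ≤ ENNReal.ofReal (S ^ d) * (ENNReal.ofReal (S⁻¹ ^ d) * V (g i '' Metric.closedBall u c)) :=
          mul_le_mul_right h1 _
      _ = _ := by
          rw [← mul_assoc, ← ENNReal.ofReal_mul (by positivity), ← mul_pow,
            mul_inv_cancel₀ hS.ne', one_pow, ENNReal.ofReal_one, one_mul]
  have hkey : (T.card : ℝ≥0∞) * (ENNReal.ofReal ((S * c) ^ d) * v) ≤
      ENNReal.ofReal ((S * (D + 1)) ^ d) * v := by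
    calc (T.card : ℝ≥0∞) * (ENNReal.ofReal ((S * c) ^ d) * v)
        = ∑ i ∈ T, ENNReal.ofReal ((S * c) ^ d) * v := by rw [Finset.sum_const, nsmul_eq_mul]
      _ ≤ ∑ i ∈ T, V (g i '' Metric.closedBall u c) := Finset.sum_le_sum fun i _ => hmeas i
      _ = V (⋃ i ∈ T, g i '' Metric.closedBall u c) := by
          refine (measure_biUnion_finset (fun i _ j _ hij => ?_) fun i _ => ?_).symm
          · exact (hdisj hij).mono (Set.image_mono hcU) (Set.image_mono hcU)
          · exact ((isCompact_closedBall u c).image (hlip i).continuous).measurableSet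
      _ ≤ V (Metric.closedBall a (S * (D + 1))) := measure_mono (Set.iUnion₂_subset hsub)
      _ = _ := by rw [Measure.addHaar_closedBall V a (by positivity)]
  rw [← mul_assoc, ENNReal.mul_le_mul_iff_left hv0 hv1, ← ENNReal.ofReal_natCast,
    ← ENNReal.ofReal_mul (by positivity), ENNReal.ofReal_le_ofReal_iff (by positivity),
    mul_pow, mul_pow, mul_left_comm, mul_le_mul_iff_right₀ (by positivity)] at hkey
  refine Nat.le_floor ?_
  rwa [div_pow, le_div_iff₀ (by positivity)]

/-- Lower bound for the distortion of a measure dominating a homogeneous subsystem. -/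
theorem exists_le_distortion_of_homogeneous {μ : Measure X} [IsProbabilityMeasure μ]
    (hμc : ∃ K, IsCompact K ∧ μ Kᶜ = 0) {U : Set X} (hU : IsOpen U) (hUne : U.Nonempty)
    {ι : Type} [Fintype ι] {g : ι → X → X} {S w : ℝ}
    (h : IsSubsystem μ U g (fun _ => S) (fun _ => w)) (hι : 1 < Fintype.card ι)
    {r β : ℝ} (hr : 0 < r) (hβ : 0 < β)
    (hm : (Fintype.card ι : ℝ) ^ (-β) ≤ Fintype.card ι * (w * S ^ r)) :
    ∃ κ, 0 < κ ∧ ∀ n : ℕ, 1 ≤ n → ∀ α : Finset X, α.Nonempty → α.card ≤ n →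
      ENNReal.ofReal (κ * (n : ℝ) ^ (-β)) ≤ distortion μ r α := by
  classical
  obtain ⟨B, hB, hμB⟩ := hμc
  obtain ⟨M₀, hM₀⟩ := exists_card_near_le hU hUne hB.isBounded
  obtain ⟨M, hM1, hM⟩ : ∃ M : ℕ, 1 ≤ M ∧ M₀ ≤ M := ⟨max M₀ 1, le_max_right _ _, le_max_left _ _⟩
  have hμB1 : μ B = 1 := (prob_compl_eq_zero_iff hB.measurableSet).1 hμB
  set m := Fintype.card ι with hmdef
  have hm1 : (1 : ℝ) < m := by exact_mod_cast hι
  have hM0 : (0 : ℝ) < M := by exact_mod_cast hM1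
  obtain ⟨i₀⟩ : Nonempty ι := Fintype.card_pos_iff.1 (by lia)
  have hS := h.ratio_pos i₀
  have hw := h.weight_pos i₀
  refine ⟨1 / 2 * (2 * M * m) ^ (-β), by positivity, fun n hn α hα hαn => ?_⟩
  have hn1 : (1 : ℝ) ≤ n := by exact_mod_cast hn
  obtain ⟨j, hj1, hj2⟩ := exists_nat_pow_near (x := 2 * n * M) (y := m) (by nlinarith) hι
  set J := j + 1 with hJ
  have hJle : m ^ J ≤ 2 * M * m * n := by rw [hJ, pow_succ]; nlinarith
  have hit := h.iterate J
  simp only [Finset.prod_const, Finset.card_univ, Fintype.card_fin] at hit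
  set bad : Finset (Fin J → ι) := α.biUnion fun a =>
    Finset.univ.filter fun ω => ∃ x ∈ B, dist (iterMap g J ω x) a < S ^ J with hbad
  have hbadcard : bad.card ≤ n * M := by
    refine (Finset.card_biUnion_le_card_mul _ _ M fun a _ => ?_).trans
      (Nat.mul_le_mul_right _ hαn)
    refine (hM₀ _ (iterMap g J) (S ^ J) (by positivity) hit.dist_eq hit.disjoint a _ ?_).trans hM
    intro i hi
    exact (Finset.mem_filter.1 hi).2
  have hgood : (m : ℝ) ^ J / 2 ≤ (badᶜ.card : ℝ) := by
    have h1 : bad.card + badᶜ.card = m ^ J := by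
      rw [Finset.card_add_card_compl, Fintype.card_fun, Fintype.card_fin]
    have h2 : m ^ J ≤ 2 * badᶜ.card := by nlinarith
    have : (m : ℝ) ^ J ≤ 2 * badᶜ.card := by exact_mod_cast h2
    linarith
  have hpiece : ∀ ω ∈ badᶜ, ENNReal.ofReal ((S ^ J) ^ r) ≤
      ∫⁻ x, ENNReal.ofReal (Metric.infDist (iterMap g J ω x) (α : Set X) ^ r) ∂μ := by
    intro ω hω
    have hfar : ∀ x ∈ B, S ^ J ≤ Metric.infDist (iterMap g J ω x) (α : Set X) := by
      intro x hx
      refine (Metric.le_infDist (by exact_mod_cast hα)).2 fun a ha => ?_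
      by_contra hlt
      refine Finset.mem_compl.1 hω (Finset.mem_biUnion.2 ⟨a, by exact_mod_cast ha, ?_⟩)
      exact Finset.mem_filter.2 ⟨Finset.mem_univ _, x, hx, not_le.1 hlt⟩
    calc ENNReal.ofReal ((S ^ J) ^ r) = ∫⁻ _ in B, ENNReal.ofReal ((S ^ J) ^ r) ∂μ := by
          rw [setLIntegral_const, hμB1, mul_one]
      _ ≤ ∫⁻ x in B, ENNReal.ofReal (Metric.infDist (iterMap g J ω x) (α : Set X) ^ r) ∂μ :=
          setLIntegral_mono' hB.measurableSet fun x hx => ENNReal.ofReal_le_ofReal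
            (Real.rpow_le_rpow (by positivity) (hfar x hx) hr.le)
      _ ≤ _ := setLIntegral_le_lintegral _ _
  have hreal : 1 / 2 * (2 * M * m) ^ (-β) * (n : ℝ) ^ (-β) ≤
      badᶜ.card * (w ^ J * (S ^ J) ^ r) := by
    have hn0 : (0 : ℝ) < n := by linarith
    have hJle' : (m : ℝ) ^ J ≤ 2 * M * m * n := by exact_mod_cast hJle
    have hm0 : (0 : ℝ) < m := by linarith
    calc 1 / 2 * (2 * M * m) ^ (-β) * (n : ℝ) ^ (-β)
        = 1 / 2 * (2 * M * m * n) ^ (-β) := by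
          rw [Real.mul_rpow (x := 2 * (M : ℝ) * m) (by positivity) hn0.le, mul_assoc]
      _ ≤ 1 / 2 * ((m : ℝ) ^ J) ^ (-β) := by
          refine mul_le_mul_of_nonneg_left ?_ (by norm_num)
          exact Real.rpow_le_rpow_of_nonpos (by positivity) hJle' (by linarith)
      _ = 1 / 2 * ((m : ℝ) ^ (-β)) ^ J := by
          rw [← Real.rpow_natCast, ← Real.rpow_natCast, ← Real.rpow_mul hm0.le,
            ← Real.rpow_mul hm0.le, mul_comm (J : ℝ)]
      _ ≤ 1 / 2 * (m * (w * S ^ r)) ^ J := by gcongr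
      _ = (m : ℝ) ^ J / 2 * (w ^ J * (S ^ J) ^ r) := by
          rw [mul_pow, mul_pow, ← Real.rpow_natCast (S ^ r), ← Real.rpow_natCast S,
            ← Real.rpow_mul hS.le, ← Real.rpow_mul hS.le, mul_comm (J : ℝ) r]
          ring
      _ ≤ _ := by gcongr
  calc ENNReal.ofReal (1 / 2 * (2 * M * m) ^ (-β) * (n : ℝ) ^ (-β))
      ≤ ENNReal.ofReal (badᶜ.card * (w ^ J * (S ^ J) ^ r)) := ENNReal.ofReal_le_ofReal hreal
    _ = ∑ ω ∈ badᶜ, ENNReal.ofReal (w ^ J) * ENNReal.ofReal ((S ^ J) ^ r) := by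
        rw [Finset.sum_const, nsmul_eq_mul, ENNReal.ofReal_mul (by positivity),
          ENNReal.ofReal_natCast, ENNReal.ofReal_mul (by positivity)]
    _ ≤ ∑ ω ∈ badᶜ, ENNReal.ofReal (w ^ J) *
          ∫⁻ x, ENNReal.ofReal (Metric.infDist (iterMap g J ω x) (α : Set X) ^ r) ∂μ :=
        Finset.sum_le_sum fun ω hω => mul_le_mul_right (hpiece ω hω) _
    _ ≤ ∑ ω, ENNReal.ofReal (w ^ J) *
          ∫⁻ x, ENNReal.ofReal (Metric.infDist (iterMap g J ω x) (α : Set X) ^ r) ∂μ :=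
        Finset.sum_le_sum_of_subset (Finset.subset_univ _)
    _ ≤ distortion μ r α := hit.sum_lintegral_le _ (measurable_ofReal_infDist_rpow r _)

theorem prod_word_eq_of_count_eq {ι : Type*} [Fintype ι] [DecidableEq ι] {k : ℕ}
    {ω ω' : Fin k → ι} (h : ∀ i, (Finset.univ.filter fun j => ω j = i).card =
      (Finset.univ.filter fun j => ω' j = i).card) (a : ι → ℝ) :
    ∏ j, a (ω j) = ∏ j, a (ω' j) := by
  have key : ∀ ω : Fin k → ι,
      ∏ j, a (ω j) = ∏ i, a i ^ (Finset.univ.filter fun j => ω j = i).card := by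
    intro ω
    rw [← Finset.prod_fiberwise Finset.univ ω]
    refine Finset.prod_congr rfl fun i _ => ?_
    rw [Finset.prod_congr rfl fun j hj => by rw [(Finset.mem_filter.1 hj).2], Finset.prod_const]
  rw [key, key]
  exact Finset.prod_congr rfl fun i _ => by rw [h]

/-- The words of a large fixed length with suitable letter counts form a homogeneous subsystem
which loses arbitrarily little of the growth of the original system. -/
theorem IsSubsystem.exists_homogeneous {X : Type*} {ι : Type} [MetricSpace X] [MeasurableSpace X]
    [BorelSpace X] [Fintype ι] {μ : Measure X} {U : Set X} {g : ι → X → X} {ρ w : ι → ℝ}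
    (h : IsSubsystem μ U g ρ w) {r θ : ℝ} (hθ : 0 < θ) (hle : ∀ i, w i * ρ i ^ r ≤ 1)
    (hsum : 1 < ∑ i, (w i * ρ i ^ r) ^ θ) :
    ∃ (κ : Type) (_ : Fintype κ) (G : κ → X → X) (S W : ℝ),
      IsSubsystem μ U G (fun _ => S) (fun _ => W) ∧ 1 < Fintype.card κ ∧ 0 < S ∧ 0 < W ∧
        1 ≤ Fintype.card κ * (W * S ^ r) ^ θ := by
  classical
  set A := ∑ i, (w i * ρ i ^ r) ^ θ with hA
  obtain ⟨k, hk⟩ : ∃ k : ℕ, ((k + 1 : ℕ) : ℝ) ^ Fintype.card ι < A ^ k := by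
    have h1 := (tendsto_pow_const_div_const_pow_of_one_lt (Fintype.card ι) hsum).comp
      (tendsto_add_atTop_nat 1)
    obtain ⟨k, hk⟩ := (h1.eventually (gt_mem_nhds (show (0 : ℝ) < 1 / A by positivity))).exists
    refine ⟨k, ?_⟩
    simp only [Function.comp_apply] at hk
    rw [div_lt_div_iff₀ (by positivity) (by positivity), one_mul, pow_succ] at hk
    exact lt_of_mul_lt_mul_right hk (by positivity)
  set T : (Fin k → ι) → ι → Fin (k + 1) := fun ω i =>
    ⟨(Finset.univ.filter fun j => ω j = i).card,
      Nat.lt_succ_of_le ((Finset.card_le_univ _).trans_eq (Fintype.card_fin k))⟩ with hT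
  obtain ⟨τ, hτ⟩ : ∃ τ, 1 < ∑ ω with T ω = τ, ∏ j, (w (ω j) * ρ (ω j) ^ r) ^ θ := by
    by_contra! hcon
    have h1 := Finset.sum_le_sum fun τ (_ : τ ∈ Finset.univ) => hcon τ
    rw [Finset.sum_fiberwise, ← Fintype.sum_pow fun i => (w i * ρ i ^ r) ^ θ] at h1
    simp only [Finset.sum_const, Finset.card_univ, Fintype.card_fun, Fintype.card_fin,
      nsmul_eq_mul, mul_one] at h1
    push_cast at h1 hk
    linarith
  obtain ⟨ω₀, hω₀⟩ : (Finset.univ.filter fun ω => T ω = τ).Nonempty := by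
    by_contra hne
    rw [Finset.not_nonempty_iff_eq_empty] at hne
    rw [hne, Finset.sum_empty] at hτ
    linarith
  have hω₀τ : T ω₀ = τ := (Finset.mem_filter.1 hω₀).2
  have hconst : ∀ ω, T ω = τ → ∀ a : ι → ℝ, ∏ j, a (ω j) = ∏ j, a (ω₀ j) := by
    intro ω hω a
    refine prod_word_eq_of_count_eq (fun i => ?_) a
    exact congrArg Fin.val (congrFun (hω.trans hω₀τ.symm) i)
  set S := ∏ j, ρ (ω₀ j) with hSdef
  set W := ∏ j, w (ω₀ j) with hWdef
  have hS : 0 < S := Finset.prod_pos fun _ _ => h.ratio_pos _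
  have hW : 0 < W := Finset.prod_pos fun _ _ => h.weight_pos _
  have hWS : W * S ^ r = ∏ j, (w (ω₀ j) * ρ (ω₀ j) ^ r) := by
    rw [Finset.prod_mul_distrib, Real.finsetProd_rpow _ _ fun j _ => (h.ratio_pos _).le]
  have hpos : ∀ i, 0 ≤ w i * ρ i ^ r := fun i =>
    mul_nonneg (h.weight_pos i).le (Real.rpow_nonneg (h.ratio_pos i).le _)
  have hWSθ : (W * S ^ r) ^ θ = ∏ j, (w (ω₀ j) * ρ (ω₀ j) ^ r) ^ θ := by
    rw [hWS, Real.finsetProd_rpow _ _ fun j _ => hpos _]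
  have hcard : 1 < (Fintype.card {ω // T ω = τ} : ℝ) * (W * S ^ r) ^ θ := by
    refine hτ.trans_eq ?_
    rw [Finset.sum_congr rfl fun ω hω => (hconst ω (Finset.mem_filter.1 hω).2
      fun i => (w i * ρ i ^ r) ^ θ), Finset.sum_const, nsmul_eq_mul, hWSθ, Fintype.card_subtype]
  have hWS1 : (W * S ^ r) ^ θ ≤ 1 := by
    refine Real.rpow_le_one (by positivity) ?_ hθ.le
    rw [hWS]
    exact Finset.prod_le_one (fun j _ => hpos _) fun j _ => hle _
  refine ⟨{ω // T ω = τ}, inferInstance, iterMap g k ∘ Subtype.val, S, W, ?_, ?_, hS, hW,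
    hcard.le⟩
  · have h1 := (h.iterate k).comp_injective (Subtype.val_injective (p := fun ω => T ω = τ))
    have h2 : (fun ω : Fin k → ι => ∏ j, ρ (ω j)) ∘ (Subtype.val : {ω // T ω = τ} → _) =
        fun _ => S := funext fun ω => hconst ω.1 ω.2 ρ
    have h3 : (fun ω : Fin k → ι => ∏ j, w (ω j)) ∘ (Subtype.val : {ω // T ω = τ} → _) =
        fun _ => W := funext fun ω => hconst ω.1 ω.2 w
    rwa [h2, h3] at h1
  · have : (1 : ℝ) < Fintype.card {ω // T ω = τ} :=
      hcard.trans_le (mul_le_of_le_one_right (Nat.cast_nonneg _) hWS1)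
    exact_mod_cast this

/-- Lower bound for the decay of the distortion of a measure dominating a subsystem. -/
theorem IsSubsystem.exists_le_distortion {μ : Measure X} [IsProbabilityMeasure μ]
    (hμc : ∃ K, IsCompact K ∧ μ Kᶜ = 0) {U : Set X} (hU : IsOpen U) (hUne : U.Nonempty)
    {ι : Type} [Fintype ι] {g : ι → X → X} {ρ w : ι → ℝ} (h : IsSubsystem μ U g ρ w)
    {r ξ : ℝ} (hr : 0 < r) (hξ : 0 < ξ) (hle : ∀ i, w i * ρ i ^ r ≤ 1)
    (hsum : 1 < ∑ i, (w i * ρ i ^ r) ^ (ξ / (ξ + r))) :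
    ∃ κ, 0 < κ ∧ ∀ n : ℕ, 1 ≤ n → ∀ α : Finset X, α.Nonempty → α.card ≤ n →
      ENNReal.ofReal (κ * (n : ℝ) ^ (-(r / ξ))) ≤ distortion μ r α := by
  have hθ : 0 < ξ / (ξ + r) := by positivity
  obtain ⟨κ, _, G, S, W, hG, hcard, hS, hW, hm⟩ := h.exists_homogeneous hθ hle hsum
  refine exists_le_distortion_of_homogeneous hμc hU hUne hG hcard hr (by positivity) ?_
  set m := Fintype.card κ
  have hm0 : (0 : ℝ) < m := by
    have : 0 < m := by lia
    exact_mod_cast this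
  have hc : 0 < W * S ^ r := by positivity
  have h1 : (m : ℝ)⁻¹ ≤ (W * S ^ r) ^ (ξ / (ξ + r)) := by
    rwa [inv_le_iff_one_le_mul₀' hm0]
  have h2 : ((m : ℝ)⁻¹) ^ ((ξ / (ξ + r))⁻¹) ≤ W * S ^ r := by
    have := Real.rpow_le_rpow (by positivity) h1 (inv_nonneg.2 hθ.le)
    rwa [Real.rpow_rpow_inv hc.le hθ.ne'] at this
  refine le_trans (le_of_eq ?_) (mul_le_mul_of_nonneg_left h2 hm0.le)
  rw [Real.inv_rpow hm0.le, ← Real.rpow_neg hm0.le]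
  nth_rewrite 2 [← Real.rpow_one (m : ℝ)]
  rw [← Real.rpow_add hm0]
  congr 1
  field_simp
  ring

end LowerBound

theorem quantErr_le {q : ℕ} {P : Measure (EuclideanSpace ℝ (Fin q))} {n : ℕ} {r v : ℝ}
    (hr : 0 < r) (hv : 0 ≤ v) {α : Finset (EuclideanSpace ℝ (Fin q))} (hα : α.Nonempty)
    (hn : α.card ≤ n) (h : distortion P r α ≤ ENNReal.ofReal v) :
    quantErr P n r ≤ v ^ (1 / r) := by
  have hmem : α ∈ {α : Finset (EuclideanSpace ℝ (Fin q)) | α.Nonempty ∧ α.card ≤ n} := ⟨hα, hn⟩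
  refine (csInf_le ?_ (Set.mem_image_of_mem _ hmem)).trans ?_
  · refine ⟨0, ?_⟩
    rintro _ ⟨β, -, rfl⟩
    exact Real.rpow_nonneg
      (integral_nonneg fun _ => Real.rpow_nonneg Metric.infDist_nonneg _) _
  · rw [integral_infDist_rpow_eq_toReal_distortion]
    refine Real.rpow_le_rpow ENNReal.toReal_nonneg ?_ (by positivity)
    exact ENNReal.toReal_le_of_le_ofReal hv h

theorem le_quantErr {q : ℕ} {P : Measure (EuclideanSpace ℝ (Fin q))} [IsProbabilityMeasure P]
    (hP : ∃ K, IsCompact K ∧ P Kᶜ = 0) {n : ℕ} (hn : 1 ≤ n) {r v : ℝ} (hr : 0 < r) (hv : 0 ≤ v)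
    (h : ∀ α : Finset (EuclideanSpace ℝ (Fin q)), α.Nonempty → α.card ≤ n →
      ENNReal.ofReal v ≤ distortion P r α) :
    v ^ (1 / r) ≤ quantErr P n r := by
  refine le_csInf ⟨_, Set.mem_image_of_mem _ ⟨Finset.singleton_nonempty 0, by simpa using hn⟩⟩ ?_
  rintro _ ⟨α, ⟨hα, hαn⟩, rfl⟩
  dsimp only
  rw [integral_infDist_rpow_eq_toReal_distortion]
  refine Real.rpow_le_rpow hv ?_ (by positivity)
  obtain ⟨D, -, hD⟩ := exists_distortion_le P hP hr hα
  exact (ENNReal.ofReal_le_iff_le_toReal (hD.trans_lt ENNReal.ofReal_lt_top).ne).1 (h α hα hαn)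

theorem mul_rpow_neg_div_rpow_inv {C r b : ℝ} (hC : 0 ≤ C) (hr : 0 < r) (n : ℕ) :
    (C * (n : ℝ) ^ (-(r / b))) ^ (1 / r) = C ^ (1 / r) * (n : ℝ) ^ (-(1 / b)) := by
  rw [Real.mul_rpow hC (by positivity), ← Real.rpow_mul (by positivity)]
  congr 2
  field_simp

/-- A sequence squeezed between the powers `n ^ (-1 / b)` for `b` near `ξ`, up to constants,
has logarithmic decay exponent `ξ`. -/
theorem tendsto_log_div_neg_log {e : ℕ → ℝ} {ξ : ℝ} (hξ : 0 < ξ)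
    (hup : ∀ b, ξ < b → ∃ C, 0 < C ∧ ∀ n : ℕ, 1 ≤ n → e n ≤ C * (n : ℝ) ^ (-(1 / b)))
    (hlo : ∀ b, 0 < b → b < ξ → ∃ C, 0 < C ∧ ∀ n : ℕ, 1 ≤ n → C * (n : ℝ) ^ (-(1 / b)) ≤ e n) :
    Tendsto (fun n : ℕ => Real.log n / (-Real.log (e n))) atTop (nhds ξ) := by
  have hpos : ∀ n : ℕ, 1 ≤ n → 0 < e n := by
    obtain ⟨C, hC, hCe⟩ := hlo (ξ / 2) (by positivity) (by linarith)
    intro n hn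
    have : (0 : ℝ) < n := by exact_mod_cast hn
    exact lt_of_lt_of_le (by positivity) (hCe n hn)
  have hlogn : Tendsto (fun n : ℕ => Real.log n) atTop atTop :=
    Real.tendsto_log_atTop.comp tendsto_natCast_atTop_atTop
  have hlog : ∀ (C a : ℝ) (n : ℕ), 0 < C → 1 ≤ n →
      Real.log (C * (n : ℝ) ^ (-(1 / (1 / a)))) = Real.log C - a * Real.log n := by
    intro C a n hC hn
    have : (0 : ℝ) < n := by exact_mod_cast hn
    rw [Real.log_mul hC.ne' (by positivity), Real.log_rpow this, one_div_one_div]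
    ring
  have key : Tendsto (fun n : ℕ => -Real.log (e n) / Real.log n) atTop (nhds ξ⁻¹) := by
    refine tendsto_order.2 ⟨fun a ha => ?_, fun a ha => ?_⟩
    · obtain ⟨a', ha', ha'ξ⟩ := exists_between (max_lt ha (inv_pos.2 hξ))
      have ha0 : 0 < a' := (le_max_right _ _).trans_lt ha'
      obtain ⟨C, hC, hCe⟩ := hup (1 / a') (by rw [one_div]; exact (lt_inv_comm₀ ha0 hξ).1 ha'ξ)
      have h1 : 0 < a' - a := sub_pos.2 ((le_max_left _ _).trans_lt ha')
      filter_upwards [hlogn.eventually_gt_atTop 0, eventually_ge_atTop 1,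
        (hlogn.const_mul_atTop h1).eventually_gt_atTop (Real.log C)] with n hn0 hn1 hn
      have h2 := Real.log_le_log (hpos n hn1) (hCe n hn1)
      rw [hlog C a' n hC hn1] at h2
      rw [lt_div_iff₀ hn0]
      linarith
    · obtain ⟨a', ha', ha'a⟩ := exists_between ha
      have ha0 : 0 < a' := (inv_pos.2 hξ).trans ha'
      obtain ⟨C, hC, hCe⟩ := hlo (1 / a') (by positivity)
        (by rw [one_div]; exact (inv_lt_comm₀ hξ ha0).1 ha')
      filter_upwards [hlogn.eventually_gt_atTop 0, eventually_ge_atTop 1,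
        (hlogn.const_mul_atTop (sub_pos.2 ha'a)).eventually_gt_atTop (-Real.log C)]
        with n hn0 hn1 hn
      have hn' : (0 : ℝ) < n := by exact_mod_cast hn1
      have h2 := Real.log_le_log (by positivity) (hCe n hn1)
      rw [hlog C a' n hC hn1] at h2
      rw [div_lt_iff₀ hn0]
      linarith
  have := key.inv₀ (inv_pos.2 hξ).ne'
  rw [inv_inv] at this
  exact this.congr fun n => inv_div _ _

theorem sum_rpow_div_add_strictAnti {ι : Type*} [Fintype ι] [Nonempty ι] {c : ι → ℝ}
    (hc : ∀ i, 0 < c i) (hc1 : ∀ i, c i < 1) {r a b : ℝ} (hr : 0 < r) (ha : 0 < a) (hab : a < b) :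
    ∑ i, c i ^ (b / (b + r)) < ∑ i, c i ^ (a / (a + r)) := by
  refine Finset.sum_lt_sum_of_nonempty Finset.univ_nonempty fun i _ => ?_
  refine Real.rpow_lt_rpow_of_exponent_gt (hc i) (hc1 i) ?_
  rw [div_lt_div_iff₀ (by linarith) (by linarith)]
  nlinarith

/-- Theorem (Zhu): under the OSC, the quantization dimension of order `r` of the
in-homogeneous self-similar measure `μ` exists and equals `ξ_r = max{ξ_{1,r}, ξ_{2,r}}`. -/
theorem quantization_dimension_exists_eq_xi
    (q N : ℕ) (hq : 1 ≤ q) (hN : 2 ≤ N) (r : ℝ) (hr : 0 < r)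
    (f : Fin N → EuclideanSpace ℝ (Fin q) → EuclideanSpace ℝ (Fin q))
    (s : Fin N → ℝ) (hs : ∀ i, s i ∈ Set.Ioo (0 : ℝ) 1)
    (hf : ∀ i x y, dist (f i x) (f i y) = s i * dist x y)
    (E : Set (EuclideanSpace ℝ (Fin q)))
    (hEcpt : IsCompact E) (hEne : E.Nonempty) (hEss : E = ⋃ i, f i '' E)
    (hEdiam : Metric.diam E = 1)
    (hOSC : ∃ U : Set (EuclideanSpace ℝ (Fin q)), U.Nonempty ∧ IsOpen U ∧
      (∀ i, f i '' U ⊆ U) ∧ Pairwise fun i j => Disjoint (f i '' U) (f j '' U))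
    (t : Fin N → ℝ) (ht : ∀ i, 0 < t i) (ht1 : ∑ i, t i = 1)
    (ν : Measure (EuclideanSpace ℝ (Fin q))) (hνP : IsProbabilityMeasure ν)
    (hνc : ∃ K, IsCompact K ∧ ν Kᶜ = 0)
    (hνss : ν = ∑ i, ENNReal.ofReal (t i) • ν.map (f i))
    (p0 : ℝ) (p : Fin N → ℝ) (hp0 : 0 < p0) (hp : ∀ i, 0 < p i)
    (hp1 : p0 + ∑ i, p i = 1)
    (μ : Measure (EuclideanSpace ℝ (Fin q))) (hμP : IsProbabilityMeasure μ)
    (hμc : ∃ K, IsCompact K ∧ μ Kᶜ = 0)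
    (hμss : μ = ENNReal.ofReal p0 • ν + ∑ i, ENNReal.ofReal (p i) • μ.map (f i))
    (ξ1 ξ2 : ℝ) (hξ1 : 0 < ξ1) (hξ2 : 0 < ξ2)
    (hξ1e : ∑ i, (t i * s i ^ r) ^ (ξ1 / (ξ1 + r)) = 1)
    (hξ2e : ∑ i, (p i * s i ^ r) ^ (ξ2 / (ξ2 + r)) = 1)
    :
    Tendsto (fun n : ℕ => Real.log n / (-Real.log (quantErr μ n r)))
      atTop (nhds (max ξ1 ξ2)) := by
  have : Nonempty (Fin N) := ⟨⟨0, by lia⟩⟩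
  obtain ⟨U, hUne, hU, hUsub, hUdisj⟩ := hOSC
  have hs0 : ∀ i, 0 < s i := fun i => (hs i).1
  have hfm : ∀ i, Measurable (f i) := fun i =>
    (LipschitzWith.of_dist_le_mul (K := ⟨s i, (hs0 i).le⟩)
      fun x y => (hf i x y).le).continuous.measurable
  have hνss' : ν = ENNReal.ofReal 0 • ν + ∑ i, ENNReal.ofReal (t i) • ν.map (f i) := by
    rwa [ENNReal.ofReal_zero, zero_smul, zero_add]
  have hsr : ∀ i, s i ^ r < 1 := fun i => Real.rpow_lt_one (hs0 i).le (hs i).2 hr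
  have hlt1 : ∀ a : Fin N → ℝ, (∀ i, 0 < a i) → ∑ i, a i ≤ 1 → ∀ i, a i * s i ^ r < 1 := by
    intro a ha hsum i
    have h1 : a i ≤ 1 :=
      (Finset.single_le_sum (fun j _ => (ha j).le) (Finset.mem_univ i)).trans hsum
    have h2 := ha i
    nlinarith [hsr i]
  have hct : ∀ i, 0 < t i * s i ^ r := fun i =>
    mul_pos (ht i) (Real.rpow_pos_of_pos (hs0 i) _)
  have hcp : ∀ i, 0 < p i * s i ^ r := fun i =>
    mul_pos (hp i) (Real.rpow_pos_of_pos (hs0 i) _)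
  have hct1 := hlt1 t ht ht1.le
  have hcp1 := hlt1 p hp (by linarith)
  have hνsub : IsSubsystem ν U f s t :=
    ⟨hf, hs0, ht, hUsub, hUdisj, fun h hh => by
      rw [lintegral_inhomogeneous hfm hνss' hh]
      exact le_add_self⟩
  have hμsub : IsSubsystem μ U f s p :=
    ⟨hf, hs0, hp, hUsub, hUdisj, fun h hh => by
      rw [lintegral_inhomogeneous hfm hμss hh]
      exact le_add_self⟩
  refine tendsto_log_div_neg_log (lt_max_of_lt_left hξ1) (fun b hb => ?_) fun b hb0 hb => ?_
  · have hb1 := (le_max_left _ _).trans_lt hb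
    have hb2 := (le_max_right _ _).trans_lt hb
    have hb0 : 0 < b := hξ1.trans hb1
    obtain ⟨K, hK, hKν⟩ := exists_codebook_rpow_bound hνc hs0 hf ht hνss' hr hb0
      ((sum_rpow_div_add_strictAnti hct hct1 hr hξ1 hb1).trans_eq hξ1e) le_rfl
      fun m hm => ⟨{0}, Finset.singleton_nonempty 0, by simpa using hm, by simp⟩
    obtain ⟨C, hC, hCμ⟩ := exists_codebook_rpow_bound hμc hs0 hf hp hμss hr hb0
      ((sum_rpow_div_add_strictAnti hcp hcp1 hr hξ2 hb2).trans_eq hξ2e)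
      (K := p0 * K) (by positivity) fun m hm => by
        obtain ⟨α, hα, hαm, hαν⟩ := hKν m hm
        refine ⟨α, hα, hαm, ?_⟩
        rw [mul_assoc, ENNReal.ofReal_mul hp0.le]
        exact mul_le_mul_right hαν _
    refine ⟨C ^ (1 / r), by positivity, fun n hn => ?_⟩
    obtain ⟨α, hα, hαn, hαμ⟩ := hCμ n hn
    rw [← mul_rpow_neg_div_rpow_inv hC.le hr]
    exact quantErr_le hr (by positivity) hα hαn hαμ
  · obtain ⟨κ, hκ, hκμ⟩ : ∃ κ, 0 < κ ∧ ∀ n : ℕ, 1 ≤ n →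
        ∀ α : Finset (EuclideanSpace ℝ (Fin q)), α.Nonempty → α.card ≤ n →
          ENNReal.ofReal (κ * (n : ℝ) ^ (-(r / b))) ≤ distortion μ r α := by
      rcases lt_max_iff.1 hb with hb1 | hb2
      · obtain ⟨κ, hκ, hκν⟩ := hνsub.exists_le_distortion hνc hU hUne hr hb0
          (fun i => (hct1 i).le)
          (hξ1e.symm.trans_lt (sum_rpow_div_add_strictAnti hct hct1 hr hb0 hb1))
        refine ⟨p0 * κ, by positivity, fun n hn α hα hαn => ?_⟩
        rw [mul_assoc, ENNReal.ofReal_mul hp0.le]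
        refine (mul_le_mul_right (hκν n hn α hα hαn) _).trans ?_
        rw [distortion, distortion,
          lintegral_inhomogeneous hfm hμss (measurable_ofReal_infDist_rpow r _)]
        exact le_self_add
      · exact hμsub.exists_le_distortion hμc hU hUne hr hb0 (fun i => (hcp1 i).le)
          (hξ2e.symm.trans_lt (sum_rpow_div_add_strictAnti hcp hcp1 hr hb0 hb2))
    refine ⟨κ ^ (1 / r), by positivity, fun n hn => ?_⟩
    rw [← mul_rpow_neg_div_rpow_inv hκ.le hr]
    exact le_quantErr hμc hn hr (by positivity) (hκμ n hn)
end

section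
/- Assume (f_i)_{i=1}^N satisfies the open set condition and that ξ_{1,r} > ξ_{2,r}. Then the ξ_r-dimensional upper quantization coefficient of μ of order r is finite: limsup_{n→∞} n^{1/ξ_r} e_{n,r}(μ) < ∞. -/
open MeasureTheory Filter

/-- The quantization cost `∫ d(x, α)^r dP` as an extended nonnegative real. -/
noncomputable def quantCost {q : ℕ} (r : ℝ) (P : Measure (EuclideanSpace ℝ (Fin q)))
    (α : Finset (EuclideanSpace ℝ (Fin q))) : ENNReal :=
  ∫⁻ x, ENNReal.ofReal (Metric.infDist x (α : Set (EuclideanSpace ℝ (Fin q))) ^ r) ∂P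

/-- Some nonempty set of at most `n` points has quantization cost at most `v`. -/
def QuantCostLE {q : ℕ} (r : ℝ) (P : Measure (EuclideanSpace ℝ (Fin q))) (n : ℕ) (v : ℝ) : Prop :=
  ∃ α : Finset (EuclideanSpace ℝ (Fin q)), α.Nonempty ∧ α.card ≤ n ∧
    quantCost r P α ≤ ENNReal.ofReal v

section

variable {q : ℕ} {r : ℝ}

lemma measurable_infDist_rpow (hr : 0 < r) (α : Finset (EuclideanSpace ℝ (Fin q))) :
    Measurable fun x => Metric.infDist x (α : Set (EuclideanSpace ℝ (Fin q))) ^ r :=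
  ((Metric.continuous_infDist_pt _).rpow_const fun _ => Or.inr hr.le).measurable

lemma quantCost_anti (hr : 0 < r) (P : Measure (EuclideanSpace ℝ (Fin q)))
    {α β : Finset (EuclideanSpace ℝ (Fin q))} (hα : α.Nonempty) (h : α ⊆ β) :
    quantCost r P β ≤ quantCost r P α := by
  refine lintegral_mono fun x => ENNReal.ofReal_le_ofReal ?_
  exact Real.rpow_le_rpow Metric.infDist_nonneg
    (Metric.infDist_le_infDist_of_subset (by exact_mod_cast h) (by exact_mod_cast hα)) hr.le

lemma quantCost_map_le (hr : 0 < r) (P : Measure (EuclideanSpace ℝ (Fin q)))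
    {g : EuclideanSpace ℝ (Fin q) → EuclideanSpace ℝ (Fin q)} {c : ℝ} (hc : 0 < c)
    (hg : ∀ x y, dist (g x) (g y) = c * dist x y)
    {α β : Finset (EuclideanSpace ℝ (Fin q))} (hα : α.Nonempty)
    (h : ∀ y ∈ α, g y ∈ β) :
    quantCost r (P.map g) β ≤ ENNReal.ofReal (c ^ r) * quantCost r P α := by
  have hgm : Measurable g := by
    have : LipschitzWith c.toNNReal g := LipschitzWith.of_dist_le_mul fun x y => by
      rw [Real.coe_toNNReal _ hc.le, hg]
    exact this.continuous.measurable
  unfold quantCost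
  rw [lintegral_map (measurable_infDist_rpow hr β).ennreal_ofReal hgm,
    ← lintegral_const_mul _ (measurable_infDist_rpow hr α).ennreal_ofReal]
  refine lintegral_mono fun x => ?_
  rw [← ENNReal.ofReal_mul (Real.rpow_nonneg hc.le _),
    ← Real.mul_rpow hc.le Metric.infDist_nonneg]
  refine ENNReal.ofReal_le_ofReal (Real.rpow_le_rpow Metric.infDist_nonneg ?_ hr.le)
  obtain ⟨y, hy, hxy⟩ := α.finite_toSet.isCompact.exists_infDist_eq_dist (by exact_mod_cast hα) x
  rw [hxy, ← hg]
  exact Metric.infDist_le_dist_of_mem (by exact_mod_cast h y (by exact_mod_cast hy))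

lemma exists_quantCost_singleton_le (hr : 0 < r) (P : Measure (EuclideanSpace ℝ (Fin q)))
    [IsProbabilityMeasure P] (hP : ∃ K, IsCompact K ∧ P Kᶜ = 0) :
    ∃ M : ℝ, 0 ≤ M ∧ quantCost r P {0} ≤ ENNReal.ofReal M := by
  obtain ⟨K, hK, hPK⟩ := hP
  obtain ⟨R, hR⟩ := hK.isBounded.subset_closedBall 0
  refine ⟨|R| ^ r, by positivity, ?_⟩
  calc quantCost r P {0} ≤ ∫⁻ _, ENNReal.ofReal (|R| ^ r) ∂P := by
        refine lintegral_mono_ae ?_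
        have : ∀ᵐ x ∂P, x ∈ K := hPK
        filter_upwards [this] with x hx
        refine ENNReal.ofReal_le_ofReal (Real.rpow_le_rpow Metric.infDist_nonneg ?_ hr.le)
        rw [Finset.coe_singleton, Metric.infDist_singleton]
        exact (Metric.mem_closedBall.1 (hR hx)).trans (le_abs_self R)
    _ = ENNReal.ofReal (|R| ^ r) := by simp

lemma QuantCostLE.of_singleton {P : Measure (EuclideanSpace ℝ (Fin q))} {M : ℝ}
    (hM : quantCost r P {0} ≤ ENNReal.ofReal M) {n : ℕ} (hn : 1 ≤ n) {v : ℝ} (hv : M ≤ v) :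
    QuantCostLE r P n v :=
  ⟨{0}, Finset.singleton_nonempty _, by simpa using hn, hM.trans (ENNReal.ofReal_le_ofReal hv)⟩

lemma QuantCostLE.mono {P : Measure (EuclideanSpace ℝ (Fin q))} {n : ℕ} {v w : ℝ}
    (h : QuantCostLE r P n v) (hvw : v ≤ w) : QuantCostLE r P n w :=
  let ⟨α, hα, hαn, hαv⟩ := h
  ⟨α, hα, hαn, hαv.trans (ENNReal.ofReal_le_ofReal hvw)⟩

/-- Combining quantizers of the pieces of a measure satisfying an in-homogeneous self-similarity
equation. -/
lemma QuantCostLE.combine {N : ℕ} (hr : 0 < r)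
    {f : Fin N → EuclideanSpace ℝ (Fin q) → EuclideanSpace ℝ (Fin q)}
    {s : Fin N → ℝ} (hs : ∀ i, 0 < s i)
    (hf : ∀ i x y, dist (f i x) (f i y) = s i * dist x y)
    {P Q : Measure (EuclideanSpace ℝ (Fin q))} {w : Fin N → ℝ} (hw : ∀ i, 0 < w i)
    {w0 : ℝ} (hw0 : 0 ≤ w0)
    (hP : P = ENNReal.ofReal w0 • Q + ∑ i, ENNReal.ofReal (w i) • P.map (f i))
    {m : Fin N → ℕ} {v : Fin N → ℝ} (hv : ∀ i, 0 ≤ v i) (h : ∀ i, QuantCostLE r P (m i) (v i))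
    {m0 : ℕ} {v0 : ℝ} (hv0 : 0 ≤ v0) (h0 : QuantCostLE r Q m0 v0) {n : ℕ}
    (hn : m0 + ∑ i, m i ≤ n) :
    QuantCostLE r P n (w0 * v0 + ∑ i, w i * s i ^ r * v i) := by
  classical
  choose α hα hαc hαv using h
  obtain ⟨β, hβ, hβc, hβv⟩ := h0
  refine ⟨β ∪ Finset.univ.biUnion fun i => (α i).image (f i), hβ.mono Finset.subset_union_left,
    ?_, ?_⟩
  · refine (Finset.card_union_le _ _).trans (le_trans (add_le_add hβc ?_) hn)
    exact Finset.card_biUnion_le.trans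
      (Finset.sum_le_sum fun i _ => Finset.card_image_le.trans (hαc i))
  · set γ := β ∪ Finset.univ.biUnion fun i => (α i).image (f i)
    have hsplit : quantCost r P γ = ENNReal.ofReal w0 * quantCost r Q γ +
        ∑ i, ENNReal.ofReal (w i) * quantCost r (P.map (f i)) γ := by
      conv_lhs => rw [hP]
      simp [quantCost, lintegral_add_measure, lintegral_finsetSum_measure,
        lintegral_smul_measure]
    have hterm : ∀ i, 0 ≤ w i * s i ^ r * v i := fun i =>
      mul_nonneg (mul_nonneg (hw i).le (Real.rpow_nonneg (hs i).le _)) (hv i)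
    rw [hsplit, ENNReal.ofReal_add (mul_nonneg hw0 hv0) (Finset.sum_nonneg fun i _ => hterm i),
      ENNReal.ofReal_sum_of_nonneg fun i _ => hterm i, ENNReal.ofReal_mul hw0]
    refine add_le_add ?_ (Finset.sum_le_sum fun i _ => ?_)
    · gcongr
      exact (quantCost_anti hr Q hβ Finset.subset_union_left).trans hβv
    · rw [mul_assoc, ENNReal.ofReal_mul (hw i).le, ENNReal.ofReal_mul (Real.rpow_nonneg (hs i).le _)]
      gcongr
      refine (quantCost_map_le hr P (hs i) (hf i) (hα i) fun y hy => ?_).trans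
        (mul_le_mul_right (hαv i) _)
      exact Finset.mem_union_right _ (Finset.mem_biUnion.2
        ⟨i, Finset.mem_univ _, Finset.mem_image_of_mem _ hy⟩)

end

lemma mul_rpow_neg_eq {r D u x : ℝ} (hr : 0 < r) (hD : 0 < D) (hu : 0 < u) (hx : 0 ≤ x) :
    u * (u ^ (D / (D + r)) * x) ^ (-(r / D)) = u ^ (D / (D + r)) * x ^ (-(r / D)) := by
  rw [Real.mul_rpow (by positivity) hx, ← Real.rpow_mul hu.le, ← mul_assoc]
  congr 1
  nth_rewrite 1 [← Real.rpow_one u]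
  rw [← Real.rpow_add hu]
  congr 1
  field_simp
  ring

lemma sum_mul_rpow_neg_le {N : ℕ} {r D : ℝ} (hr : 0 < r) (hD : 0 < D) {u : Fin N → ℝ}
    (hu : ∀ i, 0 < u i) {C x : ℝ} (hC : 0 ≤ C) (hx : 0 < x) {y : Fin N → ℝ}
    (hy : ∀ i, u i ^ (D / (D + r)) * x ≤ y i) :
    ∑ i, u i * (C * y i ^ (-(r / D))) ≤
      C * (∑ i, u i ^ (D / (D + r))) * x ^ (-(r / D)) := by
  rw [mul_assoc, Finset.sum_mul, Finset.mul_sum]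
  refine Finset.sum_le_sum fun i _ => ?_
  rw [← mul_rpow_neg_eq hr hD (hu i) hx.le, mul_left_comm]
  refine mul_le_mul_of_nonneg_left (mul_le_mul_of_nonneg_left ?_ (hu i).le) hC
  exact Real.rpow_le_rpow_of_nonpos (mul_pos (Real.rpow_pos_of_pos (hu i) _) hx) (hy i)
    (neg_nonpos.2 (by positivity))

lemma exists_forall_lt_mul {N : ℕ} {a : Fin N → ℝ} (ha : ∀ i, 0 < a i) (c : ℝ) :
    ∃ n₀ : ℕ, ∀ n : ℕ, n₀ ≤ n → ∀ i, c < a i * n := by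
  have : ∀ᶠ n : ℕ in atTop, ∀ i, c < a i * n := eventually_all.2 fun i =>
    (tendsto_natCast_atTop_atTop.const_mul_atTop (ha i)).eventually_gt_atTop c
  exact eventually_atTop.1 this

section

variable {q N : ℕ} {r : ℝ} {f : Fin N → EuclideanSpace ℝ (Fin q) → EuclideanSpace ℝ (Fin q)}
  {s : Fin N → ℝ}

/-- Upper bound on the quantization cost of a self-similar measure. -/
lemma exists_quantCostLE_selfSimilar (hN : 2 ≤ N) (hr : 0 < r) (hs : ∀ i, 0 < s i)
    (hf : ∀ i x y, dist (f i x) (f i y) = s i * dist x y)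
    {t : Fin N → ℝ} (ht : ∀ i, 0 < t i)
    {ν : Measure (EuclideanSpace ℝ (Fin q))} [IsProbabilityMeasure ν]
    (hνc : ∃ K, IsCompact K ∧ ν Kᶜ = 0)
    (hνss : ν = ∑ i, ENNReal.ofReal (t i) • ν.map (f i))
    {D : ℝ} (hD : 0 < D) (hDe : ∑ i, (t i * s i ^ r) ^ (D / (D + r)) = 1) :
    ∃ C : ℝ, 0 ≤ C ∧ ∀ n : ℕ, 1 ≤ n → QuantCostLE r ν n (C * ((n : ℝ) + 3) ^ (-(r / D))) := by
  obtain ⟨M, hM0, hM⟩ := exists_quantCost_singleton_le hr ν hνc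
  have hu : ∀ i, 0 < t i * s i ^ r := fun i =>
    mul_pos (ht i) (Real.rpow_pos_of_pos (hs i) _)
  set a : Fin N → ℝ := fun i => (t i * s i ^ r) ^ (D / (D + r)) with ha_def
  have ha : ∀ i, 0 < a i := fun i => Real.rpow_pos_of_pos (hu i) _
  obtain ⟨n₀, hn₀⟩ := exists_forall_lt_mul ha 3
  have hC0 : 0 ≤ M * ((n₀ : ℝ) + 3) ^ (r / D) := by positivity
  refine ⟨M * ((n₀ : ℝ) + 3) ^ (r / D), hC0, fun n => ?_⟩
  induction n using Nat.strong_induction_on with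
  | _ n ih =>
  intro hn
  rcases lt_or_ge n n₀ with hlt | hge
  · refine QuantCostLE.of_singleton hM hn ?_
    rw [mul_assoc]
    refine le_mul_of_one_le_right hM0 ?_
    rw [Real.rpow_neg (by positivity), ← div_eq_mul_inv, one_le_div (by positivity)]
    gcongr
  · set m : Fin N → ℕ := fun i => ⌈a i * ((n : ℝ) + 3) - 3⌉₊ with hm
    have hpos : ∀ i, 0 < a i * ((n : ℝ) + 3) - 3 := fun i => by
      nlinarith [hn₀ n hge i, ha i]
    have hm1 : ∀ i, 1 ≤ m i := fun i => Nat.one_le_ceil_iff.2 (hpos i)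
    have hsum : 1 + ∑ i, m i ≤ n := by
      have h1 : ∑ i, (m i : ℝ) ≤ ∑ i, (a i * ((n : ℝ) + 3) - 2) :=
        Finset.sum_le_sum fun i _ => by
          have := Nat.ceil_lt_add_one (hpos i).le
          simp only [hm]
          linarith
      rw [Finset.sum_sub_distrib, ← Finset.sum_mul, hDe] at h1
      simp only [Finset.sum_const, Finset.card_univ, Fintype.card_fin, nsmul_eq_mul] at h1
      have h2 : (2 : ℝ) ≤ N := by exact_mod_cast hN
      have h3 : ((1 + ∑ i, m i : ℕ) : ℝ) ≤ n := by
        push_cast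
        linarith
      exact_mod_cast h3
    have hmn : ∀ i, m i < n := fun i => by
      have := Finset.single_le_sum (f := m) (fun j _ => Nat.zero_le _) (Finset.mem_univ i)
      omega
    have h0 : QuantCostLE r (0 : Measure (EuclideanSpace ℝ (Fin q))) 1 0 :=
      ⟨{0}, Finset.singleton_nonempty _, by simp, by simp [quantCost]⟩
    refine (QuantCostLE.combine hr hs hf ht le_rfl (by simpa using hνss)
      (fun i => mul_nonneg hC0 (by positivity)) (fun i => ih (m i) (hmn i) (hm1 i))
      le_rfl h0 hsum).mono ?_
    rw [zero_mul, zero_add]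
    refine (sum_mul_rpow_neg_le hr hD hu hC0 (by positivity : 0 < (n : ℝ) + 3)
      fun i => ?_).trans_eq (by rw [hDe, mul_one])
    have := Nat.le_ceil (a i * ((n : ℝ) + 3) - 3)
    simp only [hm, ha_def] at this ⊢
    linarith

/-- Upper bound on the quantization cost of an in-homogeneous self-similar measure. -/
lemma exists_quantCostLE_inhomogeneous (hr : 0 < r) (hs : ∀ i, 0 < s i)
    (hf : ∀ i x y, dist (f i x) (f i y) = s i * dist x y)
    {ν : Measure (EuclideanSpace ℝ (Fin q))} {p0 : ℝ} (hp0 : 0 < p0)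
    {p : Fin N → ℝ} (hp : ∀ i, 0 < p i)
    {μ : Measure (EuclideanSpace ℝ (Fin q))} [IsProbabilityMeasure μ]
    (hμc : ∃ K, IsCompact K ∧ μ Kᶜ = 0)
    (hμss : μ = ENNReal.ofReal p0 • ν + ∑ i, ENNReal.ofReal (p i) • μ.map (f i))
    {D : ℝ} (hD : 0 < D) (hDe : ∑ i, (p i * s i ^ r) ^ (D / (D + r)) < 1)
    (hν : ∃ C : ℝ, 0 ≤ C ∧ ∀ n : ℕ, 1 ≤ n → QuantCostLE r ν n (C * (n : ℝ) ^ (-(r / D)))) :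
    ∃ C : ℝ, 0 ≤ C ∧ ∀ n : ℕ, 1 ≤ n → QuantCostLE r μ n (C * (n : ℝ) ^ (-(r / D))) := by
  obtain ⟨M, hM0, hM⟩ := exists_quantCost_singleton_le hr μ hμc
  obtain ⟨K, hK0, hK⟩ := hν
  have hu : ∀ i, 0 < p i * s i ^ r := fun i =>
    mul_pos (hp i) (Real.rpow_pos_of_pos (hs i) _)
  set a : Fin N → ℝ := fun i => (p i * s i ^ r) ^ (D / (D + r)) with ha_def
  have ha : ∀ i, 0 < a i := fun i => Real.rpow_pos_of_pos (hu i) _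
  set b : ℝ := ∑ i, a i
  set θ : ℝ := (1 - b) / 2 with hθ
  have hθ0 : 0 < θ := by linarith
  have hb1 : 0 < 1 - b := by linarith
  obtain ⟨n₀, hn₀⟩ := exists_forall_lt_mul (N := 1) (a := fun _ => θ) (fun _ => hθ0) (N + 1)
  set L : ℝ := p0 * (K * θ ^ (-(r / D))) with hL
  have hL0 : 0 ≤ L := by positivity
  set C : ℝ := M * (n₀ : ℝ) ^ (r / D) + L / (1 - b)
  have hC0 : 0 ≤ C := by positivity
  have hLC : L + C * b ≤ C := by
    have : L / (1 - b) ≤ C := le_add_of_nonneg_left (by positivity)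
    rw [div_le_iff₀ hb1] at this
    linarith
  refine ⟨C, hC0, fun n => ?_⟩
  induction n using Nat.strong_induction_on with
  | _ n ih =>
  intro hn
  have hn' : (0 : ℝ) < n := by exact_mod_cast hn
  rcases lt_or_ge n n₀ with hlt | hge
  · refine QuantCostLE.of_singleton hM hn ?_
    have h1 : M * (n₀ : ℝ) ^ (r / D) ≤ C := le_add_of_nonneg_right (by positivity)
    refine le_trans ?_ (mul_le_mul_of_nonneg_right h1 (by positivity))
    rw [mul_assoc]
    refine le_mul_of_one_le_right hM0 ?_
    rw [Real.rpow_neg (by positivity), ← div_eq_mul_inv, one_le_div (by positivity)]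
    gcongr
  · set m : Fin N → ℕ := fun i => ⌈a i * (n : ℝ)⌉₊ with hm
    have hpos : ∀ i, 0 < a i * (n : ℝ) := fun i => mul_pos (ha i) hn'
    have hm1 : ∀ i, 1 ≤ m i := fun i => Nat.one_le_ceil_iff.2 (hpos i)
    have hm01 : 1 ≤ ⌈θ * (n : ℝ)⌉₊ := Nat.one_le_ceil_iff.2 (mul_pos hθ0 hn')
    have hsum : ⌈θ * (n : ℝ)⌉₊ + ∑ i, m i ≤ n := by
      have h1 : ∑ i, (m i : ℝ) ≤ ∑ i, (a i * (n : ℝ) + 1) :=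
        Finset.sum_le_sum fun i _ => (Nat.ceil_lt_add_one (hpos i).le).le
      rw [Finset.sum_add_distrib, ← Finset.sum_mul] at h1
      simp only [Finset.sum_const, Finset.card_univ, Fintype.card_fin, nsmul_eq_mul] at h1
      have h2 := Nat.ceil_lt_add_one (mul_pos hθ0 hn').le
      have h3 : (N : ℝ) + 1 < θ * n := hn₀ n hge 0
      have h4 : 2 * (θ * n) + b * n = n := by rw [hθ]; ring
      have h5 : ((⌈θ * (n : ℝ)⌉₊ + ∑ i, m i : ℕ) : ℝ) ≤ n := by
        push_cast
        linarith
      exact_mod_cast h5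
    have hmn : ∀ i, m i < n := fun i => by
      have := Finset.single_le_sum (f := m) (fun j _ => Nat.zero_le _) (Finset.mem_univ i)
      omega
    refine (QuantCostLE.combine hr hs hf hp hp0.le hμss
      (fun i => mul_nonneg hC0 (by positivity)) (fun i => ih (m i) (hmn i) (hm1 i))
      (mul_nonneg hK0 (by positivity)) (hK _ hm01) hsum).mono ?_
    have hfirst : p0 * (K * (⌈θ * (n : ℝ)⌉₊ : ℝ) ^ (-(r / D))) ≤ L * (n : ℝ) ^ (-(r / D)) := by
      rw [hL, mul_assoc, mul_assoc, ← Real.mul_rpow hθ0.le hn'.le]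
      refine mul_le_mul_of_nonneg_left (mul_le_mul_of_nonneg_left ?_ hK0) hp0.le
      exact Real.rpow_le_rpow_of_nonpos (mul_pos hθ0 hn') (Nat.le_ceil _)
        (neg_nonpos.2 (by positivity))
    have hrest := sum_mul_rpow_neg_le hr hD hu hC0 hn' (y := fun i => (m i : ℝ))
      fun i => Nat.le_ceil _
    refine (add_le_add hfirst hrest).trans ?_
    rw [← add_mul]
    exact mul_le_mul_of_nonneg_right hLC (by positivity)

end

lemma quantErr_le_of_quantCostLE {q : ℕ} {r : ℝ} (hr : 0 < r)
    {P : Measure (EuclideanSpace ℝ (Fin q))} {n : ℕ} {v : ℝ} (hv : 0 ≤ v)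
    (h : QuantCostLE r P n v) : quantErr P n r ≤ v ^ (1 / r) := by
  obtain ⟨α, hα, hαn, hαv⟩ := h
  have hnn : ∀ β : Finset (EuclideanSpace ℝ (Fin q)),
      0 ≤ ∫ x, Metric.infDist x (β : Set (EuclideanSpace ℝ (Fin q))) ^ r ∂P := fun β =>
    integral_nonneg fun x => Real.rpow_nonneg Metric.infDist_nonneg _
  have hle : ∫ x, Metric.infDist x (α : Set (EuclideanSpace ℝ (Fin q))) ^ r ∂P ≤ v := by
    rw [integral_eq_lintegral_of_nonneg_ae
      (Eventually.of_forall fun x => Real.rpow_nonneg Metric.infDist_nonneg _)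
      (measurable_infDist_rpow hr α).aestronglyMeasurable]
    exact ENNReal.toReal_le_of_le_ofReal hv hαv
  refine le_trans ?_ (Real.rpow_le_rpow (hnn α) hle (by positivity : 0 ≤ 1 / r))
  refine csInf_le ⟨0, ?_⟩ ⟨α, ⟨hα, hαn⟩, rfl⟩
  rintro _ ⟨β, -, rfl⟩
  exact Real.rpow_nonneg (hnn β) _

/-- Theorem (Zhu): under the OSC, if `ξ_{1,r} > ξ_{2,r}` then the `ξ_r`-dimensional upper
quantization coefficient of `μ` of order `r` is finite: `limsup_n n^{1/ξ_r} e_{n,r}(μ) < ∞`. -/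
theorem upper_quantization_coefficient_finite_of_lt
    (q N : ℕ) (hq : 1 ≤ q) (hN : 2 ≤ N) (r : ℝ) (hr : 0 < r)
    (f : Fin N → EuclideanSpace ℝ (Fin q) → EuclideanSpace ℝ (Fin q))
    (s : Fin N → ℝ) (hs : ∀ i, s i ∈ Set.Ioo (0 : ℝ) 1)
    (hf : ∀ i x y, dist (f i x) (f i y) = s i * dist x y)
    (E : Set (EuclideanSpace ℝ (Fin q)))
    (hEcpt : IsCompact E) (hEne : E.Nonempty) (hEss : E = ⋃ i, f i '' E)
    (hEdiam : Metric.diam E = 1)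
    (hOSC : ∃ U : Set (EuclideanSpace ℝ (Fin q)), U.Nonempty ∧ IsOpen U ∧
      (∀ i, f i '' U ⊆ U) ∧ Pairwise fun i j => Disjoint (f i '' U) (f j '' U))
    (t : Fin N → ℝ) (ht : ∀ i, 0 < t i) (ht1 : ∑ i, t i = 1)
    (ν : Measure (EuclideanSpace ℝ (Fin q))) (hνP : IsProbabilityMeasure ν)
    (hνc : ∃ K, IsCompact K ∧ ν Kᶜ = 0)
    (hνss : ν = ∑ i, ENNReal.ofReal (t i) • ν.map (f i))
    (p0 : ℝ) (p : Fin N → ℝ) (hp0 : 0 < p0) (hp : ∀ i, 0 < p i)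
    (hp1 : p0 + ∑ i, p i = 1)
    (μ : Measure (EuclideanSpace ℝ (Fin q))) (hμP : IsProbabilityMeasure μ)
    (hμc : ∃ K, IsCompact K ∧ μ Kᶜ = 0)
    (hμss : μ = ENNReal.ofReal p0 • ν + ∑ i, ENNReal.ofReal (p i) • μ.map (f i))
    (ξ1 ξ2 : ℝ) (hξ1 : 0 < ξ1) (hξ2 : 0 < ξ2)
    (hξ1e : ∑ i, (t i * s i ^ r) ^ (ξ1 / (ξ1 + r)) = 1)
    (hξ2e : ∑ i, (p i * s i ^ r) ^ (ξ2 / (ξ2 + r)) = 1)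
    (hlt : ξ2 < ξ1) :
    limsup (fun n : ℕ =>
      (((n : ℝ) ^ (1 / max ξ1 ξ2) * quantErr μ n r : ℝ) : EReal)) atTop < ⊤ := by
  have hs0 : ∀ i, 0 < s i := fun i => (hs i).1
  have hp1' : ∀ i, p i < 1 := fun i => by
    have := Finset.single_le_sum (f := p) (fun j _ => (hp j).le) (Finset.mem_univ i)
    linarith
  rw [max_eq_left hlt.le]
  have hb : ∑ i, (p i * s i ^ r) ^ (ξ1 / (ξ1 + r)) < 1 := by
    rw [← hξ2e]
    refine Finset.sum_lt_sum_of_nonempty ⟨⟨0, by omega⟩, Finset.mem_univ _⟩ fun i _ => ?_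
    refine Real.rpow_lt_rpow_of_exponent_gt
      (mul_pos (hp i) (Real.rpow_pos_of_pos (hs0 i) _)) ?_ ?_
    · exact mul_lt_one_of_nonneg_of_lt_one_left (hp i).le (hp1' i)
        (Real.rpow_le_one (hs0 i).le (hs i).2.le hr.le)
    · rw [div_lt_div_iff₀ (by positivity) (by positivity)]
      nlinarith
  obtain ⟨C, hC0, hC⟩ := exists_quantCostLE_selfSimilar hN hr hs0 hf ht hνc hνss hξ1 hξ1e
  obtain ⟨C', hC'0, hC'⟩ := exists_quantCostLE_inhomogeneous hr hs0 hf hp0 hp hμc hμss hξ1 hb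
    ⟨C, hC0, fun n hn => by
      refine (hC n hn).mono ?_
      have hn0 : (0 : ℝ) < n := by exact_mod_cast hn
      exact mul_le_mul_of_nonneg_left
        (Real.rpow_le_rpow_of_nonpos hn0 (by linarith) (neg_nonpos.2 (by positivity))) hC0⟩
  refine lt_of_le_of_lt (limsup_le_of_le (h := ?_)) (EReal.coe_lt_top (C' ^ (1 / r)))
  filter_upwards [eventually_ge_atTop 1] with n hn
  have hn0 : (0 : ℝ) < n := by exact_mod_cast hn
  rw [EReal.coe_le_coe_iff]
  calc (n : ℝ) ^ (1 / ξ1) * quantErr μ n r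
      ≤ (n : ℝ) ^ (1 / ξ1) * (C' * (n : ℝ) ^ (-(r / ξ1))) ^ (1 / r) := by
        gcongr
        exact quantErr_le_of_quantCostLE hr (by positivity) (hC' n hn)
    _ = C' ^ (1 / r) := by
        rw [Real.mul_rpow hC'0 (by positivity), ← Real.rpow_mul hn0.le, mul_left_comm,
          ← Real.rpow_add hn0]
        have : 1 / ξ1 + -(r / ξ1) * (1 / r) = 0 := by field_simp; ring
        rw [this, Real.rpow_zero, mul_one]
end
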